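/- Let (X, 𝓑, μ) be a probability space with T : X → X invertible, measure-preserving, and ergodic. Let C : X × ℤ → GL(m, ℝ) be a measurable, log-integrable cocycle over T whose top Lyapunov exponent λ is simple. For a nonzero vector v, set σ(x, v, N) = log(‖C(x,N)v‖/‖v‖); call (x,v) future-Oseledets-generic if σ(x,v,N)/N → λ. Then for every x and every pair v, w such that (x,v) and (x,w) are future-Oseledets-generic, |σ(x,v,N) − σ(x,w,N)| = O_{x,v,w}(1) uniformly in N ∈ ℕ. In particular, C has simple dominated splitting with respect to any diverging normalizing sequence. -/

import Mathlib

open MeasureTheory Filter Set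

/-- Logarithmic expansion rate `σ(x,v,N) = log (‖C(x,N)v‖ / ‖v‖)` of a linear cocycle. -/
noncomputable def cocycleSigma {X : Type*} {m : ℕ}
    (C : X → ℤ → (EuclideanSpace ℝ (Fin m) ≃L[ℝ] EuclideanSpace ℝ (Fin m)))
    (x : X) (v : EuclideanSpace ℝ (Fin m)) (N : ℤ) : ℝ :=
  Real.log (‖C x N v‖ / ‖v‖)

/-- The pair `(x,v)` is future-Oseledets-generic for the top exponent `lam`:
`v ≠ 0` and `σ(x,v,N)/N → lam`. -/
def FutureOseledetsGeneric {X : Type*} {m : ℕ}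
    (C : X → ℤ → (EuclideanSpace ℝ (Fin m) ≃L[ℝ] EuclideanSpace ℝ (Fin m)))
    (lam : ℝ) (x : X) (v : EuclideanSpace ℝ (Fin m)) : Prop :=
  v ≠ 0 ∧ Tendsto (fun N : ℕ => cocycleSigma C x v (N : ℤ) / (N : ℝ)) atTop (nhds lam)

/-- The cocycle `C` has simple top Lyapunov exponent `lam` (Oseledets form): there is
`lam' < lam` such that for a.e. `x` there is a top Oseledets vector `u` with
`σ(x,u,N)/N → lam`, complemented by a subspace on which the exponential growth rate is
at most `lam'`. -/
def SimpleTopLyapunov {X : Type*} {m : ℕ} [MeasurableSpace X] (μ : Measure X)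
    (C : X → ℤ → (EuclideanSpace ℝ (Fin m) ≃L[ℝ] EuclideanSpace ℝ (Fin m)))
    (lam : ℝ) : Prop :=
  ∃ lam' : ℝ, lam' < lam ∧ ∀ᵐ x ∂μ, ∃ u : EuclideanSpace ℝ (Fin m), u ≠ 0 ∧
    Tendsto (fun N : ℕ => cocycleSigma C x u (N : ℤ) / (N : ℝ)) atTop (nhds lam) ∧
    ∃ F : Submodule ℝ (EuclideanSpace ℝ (Fin m)),
      IsCompl (Submodule.span ℝ {u}) F ∧
      ∀ v ∈ F, v ≠ 0 →
        Filter.limsup (fun N : ℕ => cocycleSigma C x v (N : ℤ) / (N : ℝ)) atTop ≤ lam'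

/-- The running maximum `max (0, S₁ f, …, Sₙ f)` of the Birkhoff sums of `f` along `T`. -/
noncomputable def birkhoffMax {X : Type*} (T : X → X) (f : X → ℝ) : ℕ → X → ℝ
  | 0 => fun _ => 0
  | n + 1 => fun x => max 0 (f x + birkhoffMax T f n (T x))

section BirkhoffMax

variable {X : Type*} {T : X → X} {f : X → ℝ}

lemma birkhoffMax_nonneg (n : ℕ) (x : X) : 0 ≤ birkhoffMax T f n x := by
  cases n with
  | zero => exact le_rfl
  | succ n => exact le_max_left _ _

lemma birkhoffMax_le_succ (n : ℕ) (x : X) :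
    birkhoffMax T f n x ≤ birkhoffMax T f (n + 1) x := by
  induction n generalizing x with
  | zero => exact birkhoffMax_nonneg _ _
  | succ n ih => exact max_le_max le_rfl (add_le_add le_rfl (ih (T x)))

lemma birkhoffSum_le_birkhoffMax (n : ℕ) (x : X) :
    birkhoffSum T f n x ≤ birkhoffMax T f n x := by
  induction n generalizing x with
  | zero => simp [birkhoffMax]
  | succ n ih =>
    rw [birkhoffSum_succ']
    exact (add_le_add le_rfl (ih (T x))).trans (le_max_right _ _)

lemma birkhoffMax_le_indicator_add (n : ℕ) (x : X) :
    birkhoffMax T f n x ≤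
      {y | 0 < birkhoffMax T f n y}.indicator f x + birkhoffMax T f n (T x) := by
  by_cases hx : 0 < birkhoffMax T f n x
  · rw [indicator_of_mem (by exact hx)]
    cases n with
    | zero => exact absurd hx (lt_irrefl _)
    | succ n =>
      have h : birkhoffMax T f (n + 1) x = f x + birkhoffMax T f n (T x) :=
        max_eq_right (lt_max_iff.1 hx |>.resolve_left (lt_irrefl _)).le
      rw [h]
      exact add_le_add le_rfl (birkhoffMax_le_succ n (T x))
  · rw [indicator_of_notMem (by exact hx), zero_add]
    exact (not_lt.1 hx).trans (birkhoffMax_nonneg n (T x))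

variable [MeasurableSpace X] {μ : Measure X}

lemma integrable_birkhoffMax (hT : MeasurePreserving T μ μ) (hf : Integrable f μ) (n : ℕ) :
    Integrable (birkhoffMax T f n) μ := by
  induction n with
  | zero => exact integrable_zero X ℝ μ
  | succ n ih =>
    exact (integrable_zero X ℝ μ).sup (hf.add (hT.integrable_comp_of_integrable ih))

lemma nullMeasurableSet_birkhoffMax_pos (hT : MeasurePreserving T μ μ) (hf : Integrable f μ)
    (n : ℕ) : NullMeasurableSet {x | 0 < birkhoffMax T f n x} μ :=
  nullMeasurableSet_lt aemeasurable_const (integrable_birkhoffMax hT hf n).aemeasurable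

/-- The maximal ergodic theorem. -/
theorem setIntegral_birkhoffMax_pos_nonneg (hT : MeasurePreserving T μ μ) (hf : Integrable f μ)
    (n : ℕ) : 0 ≤ ∫ x in {x | 0 < birkhoffMax T f n x}, f x ∂μ := by
  have hM := integrable_birkhoffMax hT hf n
  have hMT : Integrable (fun x => birkhoffMax T f n (T x)) μ :=
    hT.integrable_comp_of_integrable hM
  have hA := nullMeasurableSet_birkhoffMax_pos hT hf n
  have hfA := hf.indicator₀ hA
  have hcomp : ∫ x, birkhoffMax T f n (T x) ∂μ = ∫ x, birkhoffMax T f n x ∂μ := by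
    have h := integral_map hT.measurable.aemeasurable
      (f := birkhoffMax T f n) (by rw [hT.map_eq]; exact hM.aestronglyMeasurable)
    rw [hT.map_eq] at h
    exact h.symm
  have hle := integral_mono hM (hfA.add hMT) (birkhoffMax_le_indicator_add (T := T) (f := f) n)
  rw [integral_add' hfA hMT, integral_indicator₀ hA, hcomp] at hle
  linarith

/-- The weak-type maximal inequality for Birkhoff sums. -/
lemma mul_measureReal_birkhoffMax_pos_le [IsFiniteMeasure μ] (hT : MeasurePreserving T μ μ)
    (hf : Integrable f μ) (hf0 : 0 ≤ f) (c : ℝ) (n : ℕ) :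
    c * μ.real {x | 0 < birkhoffMax T (fun y => f y - c) n x} ≤ ∫ x, f x ∂μ := by
  have h := setIntegral_birkhoffMax_pos_nonneg hT (hf.sub (integrable_const c)) n
  simp only [Pi.sub_apply] at h
  change 0 ≤ ∫ x in {x | 0 < birkhoffMax T (fun y => f y - c) n x}, (f x - c) ∂μ at h
  rw [integral_sub hf.integrableOn (integrable_const c).integrableOn, setIntegral_const,
    smul_eq_mul] at h
  have h2 := setIntegral_le_integral (s := {x | 0 < birkhoffMax T (fun y => f y - c) n x}) hf
    (Eventually.of_forall hf0)
  linarith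

/-- Birkhoff sums of a nonnegative integrable function grow at most linearly almost everywhere. -/
theorem ae_exists_birkhoffSum_le_mul [IsFiniteMeasure μ] (hT : MeasurePreserving T μ μ)
    (hf : Integrable f μ) (hf0 : 0 ≤ f) :
    ∀ᵐ x ∂μ, ∃ c : ℝ, ∀ n : ℕ, birkhoffSum T f n x ≤ c * n := by
  have hbound (k : ℕ) : μ {x | ¬ ∃ c : ℝ, ∀ n : ℕ, birkhoffSum T f n x ≤ c * n} ≤
      ENNReal.ofReal ((∫ x, f x ∂μ) / ((k : ℝ) + 1)) := by
    set A : ℕ → Set X := fun n => {x | 0 < birkhoffMax T (fun y => f y - ((k : ℝ) + 1)) n x}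
    have hA : Monotone A :=
      monotone_nat_of_le_succ fun n x hx => lt_of_lt_of_le hx (birkhoffMax_le_succ n x)
    refine (measure_mono (t := ⋃ n, A n) fun x hx => ?_).trans ?_
    · simp only [mem_ofPred_eq, not_exists, not_forall, not_le] at hx
      obtain ⟨n, hn⟩ := hx ((k : ℝ) + 1)
      refine mem_iUnion.2 ⟨n, lt_of_lt_of_le ?_ (birkhoffSum_le_birkhoffMax n x)⟩
      have : birkhoffSum T (fun y => f y - ((k : ℝ) + 1)) n x =
          birkhoffSum T f n x - ((k : ℝ) + 1) * n := by
        simp only [birkhoffSum, Finset.sum_sub_distrib, Finset.sum_const, Finset.card_range,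
          nsmul_eq_mul, mul_comm]
      rw [this]
      exact sub_pos.2 hn
    · rw [hA.measure_iUnion]
      refine iSup_le fun n => ?_
      rw [← ofReal_measureReal]
      refine ENNReal.ofReal_le_ofReal ((le_div_iff₀ (by positivity)).2 ?_)
      rw [mul_comm]
      exact mul_measureReal_birkhoffMax_pos_le hT hf hf0 _ n
  have hlim : Tendsto (fun k : ℕ => ENNReal.ofReal ((∫ x, f x ∂μ) / ((k : ℝ) + 1))) atTop
      (nhds 0) := by
    rw [← ENNReal.ofReal_zero]
    exact ENNReal.tendsto_ofReal (tendsto_const_nhds.div_atTop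
      (tendsto_atTop_add_const_right _ _ tendsto_natCast_atTop_atTop))
  exact le_antisymm (ge_of_tendsto' hlim hbound) zero_le

end BirkhoffMax

section Cocycle

variable {X : Type*} {m : ℕ}
  {C : X → ℤ → (EuclideanSpace ℝ (Fin m) ≃L[ℝ] EuclideanSpace ℝ (Fin m))} {x : X}

lemma norm_cocycle_le_exp_birkhoffSum {T : X ≃ X}
    (hC : ∀ r s : ℤ, ∀ v, C x (r + s) v = C ((T ^ r) x) s (C x r v))
    (N : ℕ) (v : EuclideanSpace ℝ (Fin m)) :
    ‖C x N v‖ ≤ Real.exp (birkhoffSum T (fun y => max 0 (Real.log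
      ‖(C y 1 : EuclideanSpace ℝ (Fin m) →L[ℝ] EuclideanSpace ℝ (Fin m))‖)) N x) * ‖v‖ := by
  induction N with
  | zero =>
    have h : C x 0 v = v := (C x 0).injective (by simpa using (hC 0 0 v).symm)
    simp [h]
  | succ n ih =>
    have hstep : C x ((n + 1 : ℕ) : ℤ) v = C (T^[n] x) 1 (C x n v) := by
      rw [Nat.cast_succ, hC, zpow_natCast, Equiv.Perm.iterate_eq_pow]
    rw [hstep, birkhoffSum_succ, add_comm, Real.exp_add, mul_assoc]
    refine ((C (T^[n] x) 1).toContinuousLinearMap.le_opNorm _).trans ?_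
    refine mul_le_mul ?_ ih (norm_nonneg _) (Real.exp_pos _).le
    exact (Real.le_exp_log _).trans (Real.exp_le_exp.2 (le_max_right _ _))

lemma cocycleSigma_le_birkhoffSum {T : X ≃ X}
    (hC : ∀ r s : ℤ, ∀ v, C x (r + s) v = C ((T ^ r) x) s (C x r v))
    (N : ℕ) {v : EuclideanSpace ℝ (Fin m)} (hv : v ≠ 0) :
    cocycleSigma C x v N ≤ birkhoffSum T (fun y => max 0 (Real.log
      ‖(C y 1 : EuclideanSpace ℝ (Fin m) →L[ℝ] EuclideanSpace ℝ (Fin m))‖)) N x := by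
  have hCv : C x N v ≠ 0 := by simpa using hv
  refine (Real.log_le_iff_le_exp (by positivity)).2 ?_
  exact (div_le_iff₀ (norm_pos_iff.2 hv)).2 (norm_cocycle_le_exp_birkhoffSum hC N v)

lemma norm_cocycle_eq_mul_exp_sigma {v : EuclideanSpace ℝ (Fin m)} (hv : v ≠ 0) (N : ℤ) :
    ‖C x N v‖ = ‖v‖ * Real.exp (cocycleSigma C x v N) := by
  have hCv : C x N v ≠ 0 := by simpa using hv
  rw [cocycleSigma, Real.exp_log (by positivity)]
  field_simp

lemma tendsto_norm_cocycle_div_zero {u f : EuclideanSpace ℝ (Fin m)} {a b : ℝ} (hu : u ≠ 0)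
    (hab : a < b)
    (hfa : f ≠ 0 → ∀ᶠ N : ℕ in atTop, cocycleSigma C x f (N : ℤ) / (N : ℝ) < a)
    (hub : ∀ᶠ N : ℕ in atTop, b < cocycleSigma C x u (N : ℤ) / (N : ℝ)) :
    Tendsto (fun N : ℕ => ‖C x N f‖ / ‖C x N u‖) atTop (nhds 0) := by
  rcases eq_or_ne f 0 with rfl | hf
  · simp
  have hlim : Tendsto (fun N : ℕ => ‖f‖ / ‖u‖ * Real.exp ((a - b) * N)) atTop (nhds 0) := by
    rw [← mul_zero (‖f‖ / ‖u‖)]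
    exact (Real.tendsto_exp_atBot.comp (tendsto_natCast_atTop_atTop.const_mul_atTop_of_neg
      (sub_neg.2 hab))).const_mul _
  refine squeeze_zero' (Eventually.of_forall fun N => by positivity) ?_ hlim
  filter_upwards [hfa hf, hub, eventually_gt_atTop 0] with N hfN huN hN
  have hN' : (0 : ℝ) < N := Nat.cast_pos.2 hN
  rw [div_lt_iff₀ hN'] at hfN
  rw [lt_div_iff₀ hN'] at huN
  rw [norm_cocycle_eq_mul_exp_sigma hf, norm_cocycle_eq_mul_exp_sigma hu, mul_div_mul_comm,
    ← Real.exp_sub]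
  gcongr
  linarith

/-- If `v = c • u + f` with `c ≠ 0` and the images of `f` negligible against those of `u`, then
`v` and `u` have the same expansion up to a convergent error. -/
lemma tendsto_cocycleSigma_sub {u v f : EuclideanSpace ℝ (Fin m)} {c : ℝ} (hu : u ≠ 0)
    (hv : v ≠ 0) (hc : c ≠ 0) (hdec : c • u + f = v)
    (hf : Tendsto (fun N : ℕ => ‖C x N f‖ / ‖C x N u‖) atTop (nhds 0)) :
    Tendsto (fun N : ℕ => cocycleSigma C x v (N : ℤ) - cocycleSigma C x u (N : ℤ)) atTop
      (nhds (Real.log |c| + Real.log (‖u‖ / ‖v‖))) := by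
  have hCne {z : EuclideanSpace ℝ (Fin m)} (hz : z ≠ 0) (N : ℕ) : ‖C x N z‖ ≠ 0 := by
    simpa using hz
  have hratio : Tendsto (fun N : ℕ => ‖C x N v‖ / ‖C x N u‖) atTop (nhds |c|) := by
    rw [tendsto_iff_dist_tendsto_zero]
    refine squeeze_zero (fun _ => dist_nonneg) (fun N => ?_) hf
    have hpos : 0 < ‖C x N u‖ := (norm_nonneg _).lt_of_ne' (hCne hu N)
    have hsub : C x N f = C x N v - c • C x N u := by
      rw [← hdec, map_add, map_smul, add_sub_cancel_left]
    have habs := abs_norm_sub_norm_le (C x N v) (c • C x N u)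
    rw [norm_smul, Real.norm_eq_abs, ← hsub] at habs
    rw [Real.dist_eq, div_sub' hpos.ne', abs_div, abs_of_pos hpos, mul_comm]
    exact div_le_div_of_nonneg_right habs hpos.le
  refine ((hratio.log (abs_ne_zero.2 hc)).add_const _).congr fun N => ?_
  have hnu := norm_ne_zero_iff.2 hu
  have hnv := norm_ne_zero_iff.2 hv
  rw [cocycleSigma, cocycleSigma, Real.log_div (hCne hv N) (hCne hu N), Real.log_div hnu hnv,
    Real.log_div (hCne hv N) hnv, Real.log_div (hCne hu N) hnu]
  ring

/-- A future-generic vector has the same expansion as the top Oseledets vector, up to a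
convergent error. -/
lemma FutureOseledetsGeneric.exists_tendsto_sub {lam lam' : ℝ}
    {u v : EuclideanSpace ℝ (Fin m)} {F : Submodule ℝ (EuclideanSpace ℝ (Fin m))}
    (hv : FutureOseledetsGeneric C lam x v) (hlam : lam' < lam)
    (hu : FutureOseledetsGeneric C lam x u)
    (hF : Submodule.span ℝ {u} ⊔ F = ⊤)
    (hbdd : ∀ f ≠ 0, IsBoundedUnder (· ≤ ·) atTop
      fun N : ℕ => cocycleSigma C x f (N : ℤ) / (N : ℝ))
    (hslow : ∀ f ∈ F, f ≠ 0 →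
      limsup (fun N : ℕ => cocycleSigma C x f (N : ℤ) / (N : ℝ)) atTop ≤ lam') :
    ∃ L, Tendsto (fun N : ℕ => cocycleSigma C x v (N : ℤ) - cocycleSigma C x u (N : ℤ)) atTop
      (nhds L) := by
  obtain ⟨y, hy, f, hfF, hdec⟩ := Submodule.mem_sup.1 (hF ▸ Submodule.mem_top : v ∈ _ ⊔ F)
  obtain ⟨c, rfl⟩ := Submodule.mem_span_singleton.1 hy
  have hc : c ≠ 0 := by
    rintro rfl
    rw [zero_smul, zero_add] at hdec
    subst hdec
    exact (hslow f hfF hv.1).not_gt (hv.2.limsup_eq.symm ▸ hlam)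
  obtain ⟨a, ha, ha'⟩ := exists_between hlam
  obtain ⟨b, hab, hb⟩ := exists_between ha'
  exact ⟨_, tendsto_cocycleSigma_sub hu.1 hv.1 hc hdec <|
    tendsto_norm_cocycle_div_zero hu.1 hab
      (fun hf => eventually_lt_of_limsup_lt ((hslow f hfF hf).trans_lt ha) (hbdd f hf))
      (hu.2.eventually_const_lt hb)⟩

end Cocycle

/-- **Lemma (lemma:exp).** Let `C` be a measurable, log-integrable cocycle over an
invertible, measure-preserving, ergodic transformation `T`, with simple top Lyapunov
exponent `lam`. Then (for a.e. `x`) for all `v, w` such that `(x,v)` and `(x,w)` are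
future-Oseledets-generic, `|σ(x,v,N) − σ(x,w,N)| = O_{x,v,w}(1)` uniformly in `N`.
In particular, `C` has simple dominated splitting with respect to any diverging
normalizing sequence. -/
theorem simple_top_exponent_dominated_splitting
    {X : Type*} {m : ℕ} [MeasurableSpace X] (μ : Measure X) [IsProbabilityMeasure μ]
    (T : X ≃ X) (hTm : Measurable (⇑T)) (hT : Ergodic (⇑T) μ)
    (C : X → ℤ → (EuclideanSpace ℝ (Fin m) ≃L[ℝ] EuclideanSpace ℝ (Fin m)))
    (hCmeas : ∀ N : ℤ, ∀ v, Measurable fun x => C x N v)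
    (hCcocycle : ∀ᵐ x ∂μ, ∀ r s : ℤ, ∀ v, C x (r + s) v = C ((T ^ r) x) s (C x r v))
    (hlogint₁ : Integrable (fun x =>
      max 0 (Real.log ‖(C x 1 : EuclideanSpace ℝ (Fin m) →L[ℝ] EuclideanSpace ℝ (Fin m))‖)) μ)
    (hlogint₂ : Integrable (fun x =>
      max 0 (Real.log ‖(C x (-1) : EuclideanSpace ℝ (Fin m) →L[ℝ] EuclideanSpace ℝ (Fin m))‖)) μ)
    (lam : ℝ) (hsimple : SimpleTopLyapunov μ C lam) :
    (∀ᵐ x ∂μ, ∀ v w : EuclideanSpace ℝ (Fin m),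
        FutureOseledetsGeneric C lam x v → FutureOseledetsGeneric C lam x w →
        ∃ c : ℝ, ∀ N : ℕ,
          |cocycleSigma C x v (N : ℤ) - cocycleSigma C x w (N : ℤ)| ≤ c) ∧
    (∀ V : ℕ → ℝ, (∀ N, 0 < V N) → Tendsto V atTop atTop →
      ∀ᵐ x ∂μ, ∀ v w : EuclideanSpace ℝ (Fin m),
        FutureOseledetsGeneric C lam x v → FutureOseledetsGeneric C lam x w →
        Tendsto
          (fun N : ℕ => |cocycleSigma C x v (N : ℤ) - cocycleSigma C x w (N : ℤ)| / V N)
          atTop (nhds 0)) := by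
  have hkey : ∀ᵐ x ∂μ, ∀ v w : EuclideanSpace ℝ (Fin m),
      FutureOseledetsGeneric C lam x v → FutureOseledetsGeneric C lam x w →
      ∃ L, Tendsto (fun N : ℕ => |cocycleSigma C x v (N : ℤ) - cocycleSigma C x w (N : ℤ)|)
        atTop (nhds L) := by
    obtain ⟨lam', hlam, hosel⟩ := hsimple
    filter_upwards [hCcocycle, hosel, ae_exists_birkhoffSum_le_mul hT.toMeasurePreserving hlogint₁
      fun _ => le_max_left _ _] with x hCx ⟨u, hu0, hu, F, hF, hslow⟩ ⟨c, hc⟩ v w hv hw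
    have hbdd (f : EuclideanSpace ℝ (Fin m)) (hf : f ≠ 0) : IsBoundedUnder (· ≤ ·) atTop
        fun N : ℕ => cocycleSigma C x f (N : ℤ) / (N : ℝ) := by
      refine isBoundedUnder_of_eventually_le (a := c) ?_
      filter_upwards [eventually_gt_atTop 0] with N hN
      exact (div_le_iff₀ (Nat.cast_pos.2 hN)).2
        ((cocycleSigma_le_birkhoffSum hCx N hf).trans (hc N))
    obtain ⟨L, hL⟩ := hv.exists_tendsto_sub hlam ⟨hu0, hu⟩ hF.sup_eq_top hbdd hslow
    obtain ⟨L', hL'⟩ := hw.exists_tendsto_sub hlam ⟨hu0, hu⟩ hF.sup_eq_top hbdd hslow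
    exact ⟨_, ((hL.sub hL').congr fun N => sub_sub_sub_cancel_right _ _ _).abs⟩
  refine ⟨?_, fun V _ hV => ?_⟩
  · filter_upwards [hkey] with x hx v w hv hw
    obtain ⟨L, hL⟩ := hx v w hv hw
    obtain ⟨c, hc⟩ := hL.bddAbove_range
    exact ⟨c, fun N => hc (mem_range_self N)⟩
  · filter_upwards [hkey] with x hx v w hv hw
    obtain ⟨L, hL⟩ := hx v w hv hw
    exact hL.div_atTop hV
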